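/- arXiv:1209.6284 — 2 statements merged into one kernel-verified Lean document; each statement's English description precedes it below -/
import Mathlib

section
/- For any positive integers n, a, b, c with 0 < a < 2^(n+1), b·2^(n+1) + a ≤ c·2^n, and c odd, the 2-adic valuation of the Stirling number of the second kind S(c·2^n, b·2^(n+1) + a) is at least s₂(a) − 1, where s₂(a) denotes the sum of binary digits of a. -/
/-- Stirling numbers of the second kind. -/
def S : ℕ → ℕ → ℕ
  | 0, 0 => 1
  | 0, _ + 1 => 0
  | _ + 1, 0 => 0
  | n + 1, k + 1 => S n k + (k + 1) * S n (k + 1)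

/-- Sum of binary digits. -/
def s₂ (n : ℕ) : ℕ := (Nat.digits 2 n).sum

open Polynomial in
/-- The linear functional on `ℤ[X]` sending `X ^ N` to `S N k`, that is, the coefficient of the
falling factorial of degree `k`. -/
noncomputable def stirlingFunctional (k : ℕ) : ℤ[X] →ₗ[ℤ] ℤ :=
  Polynomial.lsum fun i => (S i k : ℤ) • LinearMap.id

open Polynomial in
/-- The product of `X - z`, `X - (z - 1)`, …, `X - (z - T + 1)`. -/
noncomputable def consecutiveProduct : ℕ → ℤ → ℤ[X]
  | 0, _ => 1
  | T + 1, z => (X - C z) * consecutiveProduct T (z - 1)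

/-- The sum of the `m` lowest binary digits of `k`. -/
def lowDigitSum (k m : ℕ) : ℕ := ∑ i ∈ Finset.range m, k / 2 ^ i % 2

section StirlingFunctional

open Polynomial

lemma stirlingFunctional_monomial (k i : ℕ) (a : ℤ) :
    stirlingFunctional k (monomial i a) = S i k * a := by
  simp [stirlingFunctional, Polynomial.lsum_apply, Polynomial.sum_monomial_index]

lemma stirlingFunctional_X_pow (k i : ℕ) : stirlingFunctional k (X ^ i) = S i k := by
  rw [X_pow_eq_monomial, stirlingFunctional_monomial, mul_one]

lemma stirlingFunctional_zero_X_mul (p : ℤ[X]) : stirlingFunctional 0 (X * p) = 0 := by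
  induction p using Polynomial.induction_on' with
  | add p q hp hq => rw [mul_add, map_add, hp, hq, add_zero]
  | monomial i a => rw [X_mul_monomial, stirlingFunctional_monomial]; simp [S]

lemma stirlingFunctional_succ_X_sub_mul (k : ℕ) (p : ℤ[X]) :
    stirlingFunctional (k + 1) ((X - C ((k : ℤ) + 1)) * p) = stirlingFunctional k p := by
  induction p using Polynomial.induction_on' with
  | add p q hp hq => rw [mul_add, map_add, hp, hq, map_add]
  | monomial i a =>
    rw [sub_mul, map_sub, X_mul_monomial, C_mul_monomial]
    simp only [stirlingFunctional_monomial, S]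
    push_cast
    ring

lemma stirlingFunctional_consecutiveProduct_mul (T k : ℕ) (p : ℤ[X]) :
    stirlingFunctional k (consecutiveProduct T k * p) =
      if T ≤ k then stirlingFunctional (k - T) p else 0 := by
  induction T generalizing k with
  | zero => simp [consecutiveProduct]
  | succ T ih =>
    rw [consecutiveProduct, mul_assoc]
    cases k with
    | zero => simpa using stirlingFunctional_zero_X_mul _
    | succ k =>
      push_cast
      rw [stirlingFunctional_succ_X_sub_mul, add_sub_cancel_right, ih]

lemma pow_dvd_stirlingFunctional_mul (n k : ℕ) (p : ℤ[X]) :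
    (2 : ℤ) ^ n ∣ stirlingFunctional k (2 ^ n * p) := by
  have h : (2 ^ n * p : ℤ[X]) = (2 ^ n : ℤ) • p := by
    rw [zsmul_eq_mul]; push_cast; rfl
  rw [h, map_smul]
  exact ⟨_, smul_eq_mul _ _⟩

lemma consecutiveProduct_add (m n : ℕ) (z : ℤ) :
    consecutiveProduct (m + n) z = consecutiveProduct m z * consecutiveProduct n (z - m) := by
  induction m generalizing z with
  | zero => simp [consecutiveProduct]
  | succ m ih =>
    rw [Nat.succ_add, consecutiveProduct, ih, consecutiveProduct,
      mul_assoc]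
    congr 3
    push_cast
    ring

lemma consecutiveProduct_sub_dvd (T : ℕ) (z d : ℤ) :
    C d ∣ consecutiveProduct T (z - d) - consecutiveProduct T z := by
  induction T generalizing z with
  | zero => simp [consecutiveProduct]
  | succ T ih =>
    obtain ⟨q, hq⟩ := ih (z - 1)
    rw [sub_right_comm] at hq
    refine ⟨consecutiveProduct T (z - d - 1) + (X - C z) * q, ?_⟩
    simp only [consecutiveProduct, C_sub]
    linear_combination (X - C z) * hq

lemma two_pow_dvd_consecutiveProduct_sub (n : ℕ) (z : ℤ) :
    (2 : ℤ[X]) ^ (n + 1) ∣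
      consecutiveProduct (2 ^ (n + 2)) z - X ^ 2 ^ (n + 1) * (X ^ 2 - 1) ^ 2 ^ n := by
  induction n with
  | zero =>
    obtain ⟨w, hw⟩ : ∃ w, z = 2 * w ∨ z = 2 * w + 1 := ⟨z / 2, by omega⟩
    set Y : ℤ[X] := X - 2 * C w with hY
    set e : ℤ[X] := 2 * C w ^ 2 - 2 * C w * X with he
    rcases hw with rfl | rfl
    · refine ⟨2 * e * X ^ 2 + 2 * e ^ 2 + 3 * Y ^ 3 + 3 * Y + 6 * X ^ 2 + 11 * e, ?_⟩
      simp [consecutiveProduct, hY, he]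
      ring
    · refine ⟨2 * e * X ^ 2 + 2 * e ^ 2 + Y ^ 3 - Y - e, ?_⟩
      simp [consecutiveProduct, hY, he]
      ring
  | succ n ih =>
    obtain ⟨q, hq⟩ := ih
    obtain ⟨r, hr⟩ := consecutiveProduct_sub_dvd (2 ^ (n + 2)) z (2 ^ (n + 2))
    have hsplit := consecutiveProduct_add (2 ^ (n + 2)) (2 ^ (n + 2)) z
    rw [← two_mul, ← pow_succ'] at hsplit
    push_cast at hsplit
    have hX : (X : ℤ[X]) ^ 2 ^ (n + 1 + 1) = (X ^ 2 ^ (n + 1)) ^ 2 := by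
      rw [← pow_mul, ← pow_succ]
    have hX' : (X ^ 2 - 1 : ℤ[X]) ^ 2 ^ (n + 1) = ((X ^ 2 - 1) ^ 2 ^ n) ^ 2 := by
      rw [← pow_mul, ← pow_succ]
    rw [show n + 1 + 2 = n + 2 + 1 by rfl, hsplit, hX, hX']
    simp only [map_pow, map_ofNat] at hr
    set A := consecutiveProduct (2 ^ (n + 2)) z
    set A' := consecutiveProduct (2 ^ (n + 2)) (z - 2 ^ (n + 2))
    set B : ℤ[X] := X ^ 2 ^ (n + 1)
    set D : ℤ[X] := (X ^ 2 - 1) ^ 2 ^ n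
    refine ⟨A * r + B * D * q + 2 ^ n * q ^ 2, ?_⟩
    have hA : A = B * D + 2 ^ (n + 1) * q := by linear_combination hq
    have hA' : A' = A + 2 ^ (n + 2) * r := by linear_combination hr
    rw [hA', hA]
    ring

end StirlingFunctional

section LowDigitSum

lemma lowDigitSum_add_le (k m d : ℕ) : lowDigitSum k (m + d) ≤ lowDigitSum k m + d := by
  induction d with
  | zero => simp
  | succ d ih =>
    rw [← add_assoc, lowDigitSum, Finset.sum_range_succ, ← lowDigitSum]
    omega

lemma lowDigitSum_le (k m : ℕ) : lowDigitSum k m ≤ m := by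
  simpa [lowDigitSum] using lowDigitSum_add_le k 0 m

lemma lowDigitSum_add_mul_two_pow (k b m : ℕ) :
    lowDigitSum (b * 2 ^ m + k) m = lowDigitSum k m := by
  refine Finset.sum_congr rfl fun i hi => ?_
  obtain ⟨d, rfl⟩ := Nat.exists_eq_add_of_lt (Finset.mem_range.mp hi)
  have h : b * 2 ^ (i + d + 1) + k = k + 2 ^ i * (2 * (b * 2 ^ d)) := by ring
  rw [h, Nat.add_mul_div_left _ _ (by positivity), Nat.add_mul_mod_self_left]

lemma lowDigitSum_succ_of_lt {k m : ℕ} (h : k < 2 ^ m) :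
    lowDigitSum k (m + 1) = lowDigitSum k m := by
  rw [lowDigitSum, Finset.sum_range_succ, ← lowDigitSum, Nat.div_eq_of_lt h, Nat.zero_mod, add_zero]

lemma lowDigitSum_two_pow (m : ℕ) : lowDigitSum (2 ^ m) (m + 1) = 1 := by
  have h := lowDigitSum_add_mul_two_pow 0 1 m
  rw [one_mul, add_zero] at h
  rw [lowDigitSum, Finset.sum_range_succ, ← lowDigitSum, h, Nat.div_self (by positivity)]
  simp [lowDigitSum]

lemma s₂_eq_lowDigitSum {k m : ℕ} (h : k < 2 ^ m) : s₂ k = lowDigitSum k m := by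
  induction m generalizing k with
  | zero => simp_all [s₂, lowDigitSum]
  | succ m ih =>
    have hstep : s₂ k = k % 2 + s₂ (k / 2) := by
      rcases Nat.eq_zero_or_pos k with rfl | hk
      · simp [s₂]
      · rw [s₂, Nat.digits_def' (by norm_num) hk, List.sum_cons, s₂]
    rw [hstep, ih (by rw [pow_succ] at h; omega), lowDigitSum, lowDigitSum,
      Finset.sum_range_succ', add_comm]
    simp [pow_succ', Nat.div_div_eq_div_mul]

end LowDigitSum

lemma S_pos {n k : ℕ} (hk : 0 < k) (h : k ≤ n) : 0 < S n k := by
  induction n generalizing k with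
  | zero => omega
  | succ n ih =>
    obtain ⟨k, rfl⟩ := Nat.exists_eq_succ_of_ne_zero hk.ne'
    rw [Nat.succ_eq_add_one, S]
    rcases Nat.lt_or_ge n (k + 1) with hlt | hge
    · obtain rfl : k = n := by omega
      rcases Nat.eq_zero_or_pos k with rfl | hk0
      · simp [S]
      · have := ih hk0 le_rfl
        omega
    · have := ih hk hge
      positivity

lemma S_eq_zero_of_lt {n k : ℕ} (h : n < k) : S n k = 0 := by
  induction n generalizing k with
  | zero => obtain ⟨k, rfl⟩ := Nat.exists_eq_succ_of_ne_zero h.ne'; simp [S]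
  | succ n ih =>
    obtain ⟨k, rfl⟩ := Nat.exists_eq_succ_of_ne_zero (by omega : k ≠ 0)
    rw [Nat.succ_eq_add_one, S, ih (by omega), ih (by omega), mul_zero, add_zero]

open Polynomial in
/-- A linear recurrence for Stirling numbers modulo powers of two. -/
lemma two_pow_dvd_stirling_recurrence (n N k : ℕ) (hN : 2 ^ (n + 2) ≤ N) :
    (2 : ℤ) ^ (n + 1) ∣
      (if 2 ^ (n + 2) ≤ k then (S (N - 2 ^ (n + 2)) (k - 2 ^ (n + 2)) : ℤ) else 0) -
      ∑ t ∈ Finset.range (2 ^ n + 1), (-1) ^ t * ((2 ^ n).choose t : ℤ) * S (N - 2 * t) k := by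
  obtain ⟨q, hq⟩ := two_pow_dvd_consecutiveProduct_sub n k
  have hL := stirlingFunctional_consecutiveProduct_mul (2 ^ (n + 2)) k (X ^ (N - 2 ^ (n + 2)))
  simp only [stirlingFunctional_X_pow] at hL
  have hexp : (X ^ 2 ^ (n + 1) * (X ^ 2 - 1) ^ 2 ^ n : ℤ[X]) * X ^ (N - 2 ^ (n + 2)) =
      ∑ t ∈ Finset.range (2 ^ n + 1), ((-1) ^ t * ((2 ^ n).choose t : ℤ)) • X ^ (N - 2 * t) := by
    rw [sub_eq_neg_add, add_pow, Finset.mul_sum, Finset.sum_mul]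
    refine Finset.sum_congr rfl fun t ht => ?_
    have ht' := Finset.mem_range.mp ht
    have hN' : N - 2 * t = 2 ^ (n + 1) + 2 * (2 ^ n - t) + (N - 2 ^ (n + 2)) := by
      rw [pow_succ] at hN ⊢
      rw [pow_succ] at hN ⊢
      omega
    rw [hN', zsmul_eq_mul]
    push_cast
    ring
  have hS : stirlingFunctional k
      ((X ^ 2 ^ (n + 1) * (X ^ 2 - 1) ^ 2 ^ n : ℤ[X]) * X ^ (N - 2 ^ (n + 2))) =
      ∑ t ∈ Finset.range (2 ^ n + 1), (-1) ^ t * ((2 ^ n).choose t : ℤ) * S (N - 2 * t) k := by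
    rw [hexp, map_sum]
    exact Finset.sum_congr rfl fun t _ => by
      rw [map_smul, stirlingFunctional_X_pow, smul_eq_mul]
  rw [← hL, ← hS, ← map_sub, ← sub_mul, hq, mul_assoc]
  exact pow_dvd_stirlingFunctional_mul _ _ _

lemma two_pow_dvd_choose_two_pow {n j u t : ℕ} (ht : t = 2 ^ j * u) (hu : Odd u) (hj : j ≤ n) :
    2 ^ (n - j) ∣ (2 ^ n).choose t := by
  have hpos : 0 < t := ht ▸ Nat.mul_pos (by positivity) hu.pos
  obtain ⟨r, rfl⟩ := Nat.exists_eq_succ_of_ne_zero hpos.ne'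
  obtain ⟨M, hM⟩ := Nat.exists_eq_succ_of_ne_zero (pow_ne_zero n two_ne_zero : (2 : ℕ) ^ n ≠ 0)
  have h := Nat.add_one_mul_choose_eq M r
  rw [← Nat.succ_eq_add_one M, ← hM] at h
  have hd : 2 ^ j * 2 ^ (n - j) ∣ 2 ^ j * (u * (2 ^ n).choose (r + 1)) := by
    rw [← pow_add, Nat.add_sub_cancel' hj, ← mul_assoc, ← ht, Nat.succ_eq_add_one,
      mul_comm (r + 1), ← h]
    exact dvd_mul_right _ _
  have hd' := Nat.dvd_of_mul_dvd_mul_left (by positivity) hd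
  exact (Nat.Coprime.pow_left _ (Nat.coprime_two_left.mpr hu)).dvd_of_dvd_mul_left hd'

theorem two_pow_lowDigitSum_dvd_S (N : ℕ) :
    ∀ n k : ℕ, 2 ^ n ∣ N → 2 ^ (lowDigitSum k (n + 1) - 1) ∣ S N k := by
  induction N using Nat.strong_induction_on with
  | _ N ih =>
  have large : ∀ n k : ℕ, 2 ^ n ∣ N → 2 ^ (n + 1) ≤ N →
      2 ^ (lowDigitSum k (n + 1) - 1) ∣ S N k := by
    intro n k hd hN
    cases n with
    | zero =>
      have := lowDigitSum_le k 1
      simp [Nat.sub_eq_zero_of_le this]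
    | succ n =>
      have hN0 : 0 < 2 ^ (n + 2) := by positivity
      have hrec := two_pow_dvd_stirling_recurrence n N k hN
      rw [Finset.sum_range_succ'] at hrec
      have hle := lowDigitSum_le k (n + 2)
      have hpow := (pow_dvd_pow (2 : ℤ) (by omega : lowDigitSum k (n + 2) - 1 ≤ n + 1)).trans hrec
      have hshift : (2 : ℤ) ^ (lowDigitSum k (n + 2) - 1) ∣
          if 2 ^ (n + 2) ≤ k then (S (N - 2 ^ (n + 2)) (k - 2 ^ (n + 2)) : ℤ) else 0 := by
        split_ifs with hk
        · have h := ih (N - 2 ^ (n + 2)) (by omega) (n + 1) (k - 2 ^ (n + 2))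
            (Nat.dvd_sub hd (pow_dvd_pow 2 (by omega)))
          have hs := lowDigitSum_add_mul_two_pow (k - 2 ^ (n + 2)) 1 (n + 2)
          rw [one_mul, Nat.add_sub_cancel' hk] at hs
          rw [hs]
          exact_mod_cast h
        · exact dvd_zero _
      have hsum : (2 : ℤ) ^ (lowDigitSum k (n + 2) - 1) ∣
          ∑ t ∈ Finset.range (2 ^ n), (-1) ^ (t + 1) * ((2 ^ n).choose (t + 1) : ℤ) *
            S (N - 2 * (t + 1)) k := by
        refine Finset.dvd_sum fun t ht => ?_
        have ht' := Finset.mem_range.mp ht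
        obtain ⟨j, u, hu, htu⟩ := Nat.exists_eq_two_pow_mul_odd (Nat.succ_ne_zero t)
        rw [Nat.succ_eq_add_one] at htu
        have hj : j ≤ n := by
          have : 2 ^ j ≤ 2 ^ n := by
            calc 2 ^ j ≤ 2 ^ j * u := Nat.le_mul_of_pos_right _ hu.pos
              _ ≤ 2 ^ n := by omega
          exact (Nat.pow_le_pow_iff_right (by norm_num)).mp this
        have hchoose := two_pow_dvd_choose_two_pow htu hu hj
        have h2t : 2 ^ (j + 1) ∣ 2 * (t + 1) := ⟨u, by rw [htu]; ring⟩
        have hS := ih (N - 2 * (t + 1)) (by omega) (j + 1) k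
          (Nat.dvd_sub ((pow_dvd_pow 2 (by omega)).trans hd) h2t)
        have hdig := lowDigitSum_add_le k (j + 2) (n - j)
        rw [show j + 2 + (n - j) = n + 2 by omega] at hdig
        have hmul : 2 ^ (lowDigitSum k (n + 2) - 1) ∣
            (2 ^ n).choose (t + 1) * S (N - 2 * (t + 1)) k := by
          refine (pow_dvd_pow 2 ?_).trans ((pow_add 2 _ _).dvd.trans (mul_dvd_mul hchoose hS))
          change _ ≤ n - j + (lowDigitSum k (j + 2) - 1)
          omega
        rw [mul_assoc]
        exact Dvd.dvd.mul_left (by exact_mod_cast hmul) _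
      have h := (hshift.sub hpow).sub hsum
      have hfin : (2 : ℤ) ^ (lowDigitSum k (n + 2) - 1) ∣ (S N k : ℤ) := by
        refine h.trans (dvd_of_eq ?_)
        simp only [pow_zero, Nat.choose_zero_right, Nat.cast_one, mul_one, one_mul, mul_zero,
          Nat.sub_zero]
        ring
      exact_mod_cast hfin
  intro n k hd
  rcases Nat.eq_zero_or_pos N with rfl | hN
  · cases k with
    | zero => simp [lowDigitSum]
    | succ k => simp [S]
  by_cases hlarge : 2 ^ (n + 1) ≤ N
  · exact large n k hd hlarge
  obtain rfl : N = 2 ^ n := by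
    obtain ⟨c, rfl⟩ := hd
    have hc : c < 2 := by
      rw [pow_succ, not_le] at hlarge
      exact lt_of_mul_lt_mul_left hlarge (Nat.zero_le _)
    have hc0 : 0 < c := Nat.pos_of_mul_pos_left hN
    obtain rfl : c = 1 := by omega
    rw [mul_one]
  rcases lt_trichotomy k (2 ^ n) with hk | rfl | hk
  · rw [lowDigitSum_succ_of_lt hk]
    cases n with
    | zero => simp [lowDigitSum]
    | succ n => exact large n k (pow_dvd_pow 2 (by omega)) le_rfl
  · simp [lowDigitSum_two_pow]
  · simp [S_eq_zero_of_lt hk]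

theorem stmt0 (n a b c : ℕ) (hn : 0 < n) (hb : 0 < b) (hc : 0 < c)
    (hodd : Odd c) (ha0 : 0 < a) (ha : a < 2 ^ (n + 1))
    (hle : b * 2 ^ (n + 1) + a ≤ c * 2 ^ n) :
    s₂ a - 1 ≤ padicValNat 2 (S (c * 2 ^ n) (b * 2 ^ (n + 1) + a)) := by
  have h := two_pow_lowDigitSum_dvd_S (c * 2 ^ n) n (b * 2 ^ (n + 1) + a) (dvd_mul_left _ _)
  rw [lowDigitSum_add_mul_two_pow, ← s₂_eq_lowDigitSum ha] at h
  have hpos : 0 < S (c * 2 ^ n) (b * 2 ^ (n + 1) + a) := S_pos (by omega) hle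
  exact (padicValNat_dvd_iff_le hpos.ne').mp h
end

section
/- Let a, c, n be positive integers with c odd, n ≥ 2, and 1 ≤ a ≤ 2^n. Then ν₂(S(c·2^n, (c−1)·2^n + a)) = s₂(a) − 1. -/
open PowerSeries in
/-- The series `(exp (2X) - 1) / 2` has 2-adically integral coefficients. -/
lemma exists_halfExp : ∃ E : PowerSeries ℤ_[2],
    constantCoeff E = 0 ∧ derivative ℤ_[2] E = 1 + 2 * E := by
  have h : ∀ i : ℕ, ∃ x : ℤ_[2], ((i + 1).factorial : ℤ_[2]) * x = 2 ^ i := by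
    intro i
    have hlt := padicValNat_factorial_lt_of_ne_zero 2 (Nat.add_one_ne_zero i)
    obtain ⟨k, m, hm, hkm⟩ := Nat.exists_eq_two_pow_mul_odd (i + 1).factorial_ne_zero
    have hk : k ≤ i := by
      have := (padicValNat_dvd_iff_le (i + 1).factorial_ne_zero).1 ⟨m, hkm⟩
      omega
    have hu : IsUnit (m : ℤ_[2]) := by
      rw [PadicInt.isUnit_iff, PadicInt.norm_natCast_eq_one_iff]
      exact hm.coprime_two_left
    obtain ⟨v, hv⟩ := hu.exists_right_inv
    refine ⟨2 ^ (i - k) * v, ?_⟩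
    rw [hkm]
    push_cast
    rw [← Nat.add_sub_cancel' hk, pow_add, Nat.add_sub_cancel' hk]
    linear_combination 2 ^ k * 2 ^ (i - k) * hv
  choose e he using h
  have hrec : ∀ i : ℕ, ((i : ℤ_[2]) + 2) * e (i + 1) = 2 * e i := by
    intro i
    have h0 : ((i + 1).factorial : ℤ_[2]) ≠ 0 := by exact_mod_cast (i + 1).factorial_ne_zero
    have h1 := he (i + 1)
    rw [Nat.factorial_succ, pow_succ, ← he i] at h1
    push_cast at h1
    apply mul_left_cancel₀ h0
    linear_combination h1
  have h0 : e 0 = 1 := by simpa using he 0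
  refine ⟨mk fun i => i.casesOn 0 e, by simp [← coeff_zero_eq_constantCoeff_apply], ?_⟩
  ext i
  rw [coeff_derivative, show (2 : PowerSeries ℤ_[2]) = C 2 from (map_ofNat C 2).symm, map_add,
    coeff_C_mul]
  cases i with
  | zero => simp [h0]
  | succ i =>
    simp [coeff_one]
    linear_combination hrec i

open PowerSeries in
/-- The coefficients of the powers of `(exp (2X) - 1) / 2` in terms of Stirling numbers. -/
lemma factorial_mul_coeff_halfExp_pow {E : PowerSeries ℤ_[2]} (h0 : constantCoeff E = 0)
    (hE : derivative ℤ_[2] E = 1 + 2 * E) (N k : ℕ) :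
    2 ^ k * (N.factorial : ℤ_[2]) * coeff N (E ^ k) = k.factorial * 2 ^ N * S N k := by
  induction N generalizing k with
  | zero => cases k <;> simp [S, h0]
  | succ N ih =>
    cases k with
    | zero => simp [S, coeff_one]
    | succ k =>
      have h := congrArg (coeff N) (derivative_pow E (k + 1))
      have h' : ((k + 1 : ℕ) : PowerSeries ℤ_[2]) * E ^ (k + 1 - 1) * (1 + 2 * E)
          = C ((k : ℤ_[2]) + 1) * (E ^ k + C 2 * E ^ (k + 1)) := by
        rw [map_ofNat, map_add, map_natCast, map_one, Nat.add_sub_cancel]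
        push_cast
        ring
      rw [hE, h', coeff_C_mul, map_add, coeff_C_mul, coeff_derivative] at h
      have h1 := ih k
      have h2 := ih (k + 1)
      simp only [S, Nat.factorial_succ] at h2 ⊢
      push_cast at h2 ⊢
      linear_combination 2 ^ (k + 1) * (N.factorial : ℤ_[2]) * h + 2 * ((k : ℤ_[2]) + 1) * h1 +
        2 * ((k : ℤ_[2]) + 1) * h2

lemma PowerSeries.sq_eq_expand (f : PowerSeries (ZMod 2)) :
    f ^ 2 = f.expand 2 two_ne_zero := by
  have h := MvPowerSeries.map_frobenius_expand 2 two_ne_zero (f := f)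
  rw [ZMod.frobenius_zmod] at h
  rw [← h]
  rfl

lemma natCast_doubleFactorial_odd (i : ℕ) :
    ((Nat.doubleFactorial (2 * i + 1) : ℕ) : ZMod 2) = 1 := by
  induction i with
  | zero => simp
  | succ i ih =>
    rw [show 2 * (i + 1) + 1 = 2 * i + 1 + 2 by ring, Nat.doubleFactorial_add_two]
    push_cast
    rw [ih, show (2 : ZMod 2) = 0 from rfl]
    ring

open PowerSeries in
/-- Modulo 2, the series `(exp (2X) - 1) / 2` is a root of `Y ^ 2 = Y + X`. -/
lemma map_halfExp_sq {E : PowerSeries ℤ_[2]} (h0 : constantCoeff E = 0)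
    (hE : derivative ℤ_[2] E = 1 + 2 * E) :
    (E.map PadicInt.toZMod) ^ 2 = E.map PadicInt.toZMod + X := by
  have h2 : (2 : ZMod 2) = 0 := rfl
  have hfac : ∀ i, ((i + 1).factorial : ℤ_[2]) * coeff (i + 1) E = 2 ^ i := by
    intro i
    have h := factorial_mul_coeff_halfExp_pow h0 hE (i + 1) 1
    have hS : ∀ i, S (i + 1) 1 = 1 := by
      intro i
      induction i with
      | zero => simp [S]
      | succ i ih => rw [S, ih]; simp [S]
    rw [hS] at h
    apply mul_left_cancel₀ (two_ne_zero (α := ℤ_[2]))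
    simp at h
    linear_combination h
  rw [sq_eq_expand]
  ext i
  rw [coeff_expand, map_add, coeff_map, coeff_map, coeff_X]
  rcases Nat.even_or_odd' i with ⟨j, rfl | rfl⟩
  · cases j with
    | zero => simp [h0]
    | succ j =>
      have key : ((Nat.doubleFactorial (2 * j + 1) : ℕ) : ℤ_[2]) * coeff (2 * (j + 1)) E
          = coeff (j + 1) E := by
        have ha := hfac (2 * j + 1)
        have hb := hfac j
        rw [Nat.factorial_eq_mul_doubleFactorial, show 2 * j + 1 + 1 = 2 * (j + 1) by ring,
          Nat.doubleFactorial_two_mul] at ha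
        have hne : (2 : ℤ_[2]) ^ (j + 1) * ((j + 1).factorial : ℤ_[2]) ≠ 0 := by
          exact_mod_cast mul_ne_zero (by positivity) (j + 1).factorial_ne_zero
        apply mul_left_cancel₀ hne
        push_cast at ha
        rw [mul_assoc _ _ (coeff (j + 1) E), hb, ← mul_assoc, ha]
        ring
      have h := congrArg PadicInt.toZMod key
      rw [map_mul, map_natCast, natCast_doubleFactorial_odd, one_mul] at h
      simp [h, show 2 * (j + 1) ≠ 1 by omega]
  · rw [if_neg (by omega)]
    have h := congrArg (coeff (2 * j)) hE
    rw [coeff_derivative, show (2 : PowerSeries ℤ_[2]) = C 2 from (map_ofNat C 2).symm, map_add,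
    coeff_C_mul] at h
    have h := congrArg PadicInt.toZMod h
    cases j with
    | zero => simp [h0] at h; simp [h]; decide
    | succ j =>
      rw [coeff_one, if_neg (by omega), zero_add, map_mul, map_mul] at h
      simpa [show PadicInt.toZMod (p := 2) 2 = 0 from (map_ofNat _ 2).trans h2] using h.symm

open PowerSeries in
/-- Over `𝔽₂`, if `G ^ 2 = G + X` and `G` has no constant term, then the coefficient of
`X ^ ((b + 1) * 2 ^ n)` in `G ^ k` is `1` for `b * 2 ^ n < k ≤ (b + 1) * 2 ^ n`. -/
lemma coeff_pow_eq_one {G : PowerSeries (ZMod 2)} (h0 : constantCoeff G = 0)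
    (hG : G ^ 2 = G + X) (b n a : ℕ) (ha0 : 1 ≤ a) (ha : a ≤ 2 ^ n) :
    coeff ((b + 1) * 2 ^ n) (G ^ (b * 2 ^ n + a)) = 1 := by
  have heven : ∀ N k, coeff (2 * N) (G ^ (2 * k)) = coeff N (G ^ k) := by
    intro N k
    rw [mul_comm 2 k, pow_mul, sq_eq_expand, coeff_expand_mul]
  have hodd : ∀ N k, coeff (2 * N + 1) (G ^ (2 * k)) = 0 := by
    intro N k
    rw [mul_comm 2 k, pow_mul, sq_eq_expand, coeff_expand_of_not_dvd]
    omega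
  have hstep : ∀ N k, coeff (2 * (N + 1)) (G ^ (2 * k + 1)) = coeff (N + 1) (G ^ (k + 1)) := by
    intro N k
    have h : G ^ (2 * (k + 1)) = G ^ (2 * k + 1) + G ^ (2 * k) * X := by
      rw [mul_add, pow_add, mul_one, hG]
      ring
    rw [← heven _ (k + 1), h, map_add, show 2 * (N + 1) = 2 * N + 1 + 1 by ring, coeff_succ_mul_X, hodd,
      add_zero]
  induction n generalizing a with
  | zero =>
    obtain rfl : a = 1 := by simp at ha; omega
    obtain ⟨H, hH⟩ := X_dvd_iff.2 h0
    have hc : constantCoeff H = 1 := by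
      have h := congrArg (coeff 1) hG
      rw [hH, mul_pow, map_add, coeff_X_pow_mul', if_neg (by norm_num), coeff_one_X,
        show (1 : ℕ) = 0 + 1 from rfl, coeff_succ_X_mul, coeff_zero_eq_constantCoeff_apply] at h
      generalize constantCoeff H = x at h
      revert h x
      decide
    rw [pow_zero, mul_one, mul_one, hH, mul_pow]
    have h := coeff_X_pow_mul (H ^ (b + 1)) (b + 1) 0
    rw [zero_add] at h
    simp [h, hc]
  | succ n ih =>
    rw [pow_succ] at ha
    obtain ⟨M, hM⟩ : ∃ M, (b + 1) * 2 ^ n = M + 1 :=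
      Nat.exists_eq_succ_of_ne_zero (by positivity)
    rcases Nat.even_or_odd' a with ⟨j, rfl | rfl⟩
    · rw [← ih j (by omega) (by omega), ← heven _ (b * 2 ^ n + j)]
      congr 2 <;> ring
    · rw [← ih (j + 1) (by omega) (by omega), hM, ← add_assoc (b * 2 ^ n), ← hstep _ (b * 2 ^ n + j),
        ← hM]
      congr 2 <;> ring

lemma s₂_two_mul (n : ℕ) : s₂ (2 * n) = s₂ n := by
  rcases n.eq_zero_or_pos with rfl | h
  · rfl
  · rw [s₂, s₂, Nat.digits_def' one_lt_two (by omega)]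
    simp

lemma s₂_two_mul_add_one (n : ℕ) : s₂ (2 * n + 1) = s₂ n + 1 := by
  rw [s₂, s₂, Nat.digits_def' one_lt_two (by omega), List.sum_cons, add_comm]
  congr 3 <;> omega

lemma s₂_mul_two_pow_add (b n a : ℕ) (ha : a < 2 ^ n) : s₂ (b * 2 ^ n + a) = s₂ b + s₂ a := by
  induction n generalizing a with
  | zero =>
    obtain rfl : a = 0 := by simpa using ha
    simp [s₂]
  | succ n ih =>
    rw [pow_succ] at ha
    rcases Nat.even_or_odd' a with ⟨j, rfl | rfl⟩
    · rw [s₂_two_mul, ← ih j (by omega), ← s₂_two_mul (b * 2 ^ n + j)]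
      ring_nf
    · rw [s₂_two_mul_add_one, ← add_assoc (s₂ b), ← ih j (by omega), ← s₂_two_mul_add_one]
      ring_nf

lemma s₂_mul_two_pow (b n : ℕ) : s₂ (b * 2 ^ n) = s₂ b := by
  simpa [s₂] using s₂_mul_two_pow_add b n 0 (by positivity)

lemma padicValNat_factorial_add_s₂ (n : ℕ) : padicValNat 2 n.factorial + s₂ n = n := by
  have h := sub_one_mul_padicValNat_factorial (p := 2) n
  have := Nat.digit_sum_le 2 n
  rw [s₂]
  omega

lemma PadicInt.valuation_natCast_two (n : ℕ) : (n : ℤ_[2]).valuation = padicValNat 2 n := by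
  have h := PadicInt.valuation_coe (n : ℤ_[2])
  rw [PadicInt.coe_natCast, Padic.valuation_natCast] at h
  exact_mod_cast h.symm

/-- If the `X ^ N` coefficient of `((exp (2X) - 1) / 2) ^ k` is a 2-adic unit, then `S N k` attains
the lower bound `s₂ k - s₂ N` for its 2-adic valuation. -/
lemma padicValNat_S_add_s₂ {N k : ℕ} {u : ℤ_[2]} (hu : IsUnit u)
    (h : 2 ^ k * (N.factorial : ℤ_[2]) * u = k.factorial * 2 ^ N * S N k) :
    padicValNat 2 (S N k) + s₂ N = s₂ k := by
  have hN : (N.factorial : ℤ_[2]) ≠ 0 := by exact_mod_cast N.factorial_ne_zero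
  have hk : (k.factorial : ℤ_[2]) ≠ 0 := by exact_mod_cast k.factorial_ne_zero
  have h2 : ∀ m : ℕ, (2 : ℤ_[2]) ^ m ≠ 0 := fun m => pow_ne_zero m two_ne_zero
  have hS : (S N k : ℤ_[2]) ≠ 0 := by
    intro h0
    rw [h0, mul_zero] at h
    exact mul_ne_zero (mul_ne_zero (h2 k) hN) hu.ne_zero h
  have hval : u.valuation = 0 := by
    obtain ⟨v, hv⟩ := hu.exists_right_inv
    have hv0 : v ≠ 0 := by rintro rfl; simp at hv
    have := PadicInt.valuation_mul hu.ne_zero hv0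
    rw [hv, PadicInt.valuation_one] at this
    omega
  have htwo : (2 : ℤ_[2]).valuation = 1 := PadicInt.valuation_p (p := 2)
  have hv := congrArg PadicInt.valuation h
  rw [PadicInt.valuation_mul (mul_ne_zero (h2 k) hN) hu.ne_zero, PadicInt.valuation_mul (h2 k) hN,
    PadicInt.valuation_mul (mul_ne_zero hk (h2 N)) hS, PadicInt.valuation_mul hk (h2 N),
    PadicInt.valuation_pow, PadicInt.valuation_pow, htwo, hval, PadicInt.valuation_natCast_two,
    PadicInt.valuation_natCast_two, PadicInt.valuation_natCast_two] at hv
  have := padicValNat_factorial_add_s₂ N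
  have := padicValNat_factorial_add_s₂ k
  omega

theorem stmt1 (a c n : ℕ) (hc : 0 < c) (hodd : Odd c) (hn : 2 ≤ n)
    (ha0 : 1 ≤ a) (ha : a ≤ 2 ^ n) :
    padicValNat 2 (S (c * 2 ^ n) ((c - 1) * 2 ^ n + a)) = s₂ a - 1 := by
  obtain ⟨d, rfl⟩ := hodd
  obtain ⟨E, h0, hE⟩ := exists_halfExp
  rw [Nat.add_sub_cancel]
  have hcoeff := coeff_pow_eq_one (G := E.map PadicInt.toZMod)
    (by simp [← PowerSeries.coeff_zero_eq_constantCoeff_apply, h0])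
    (map_halfExp_sq h0 hE) (2 * d) n a ha0 ha
  rw [← map_pow, PowerSeries.coeff_map] at hcoeff
  have hu : IsUnit (PowerSeries.coeff ((2 * d + 1) * 2 ^ n) (E ^ (2 * d * 2 ^ n + a))) := by
    by_contra hnu
    have hmem := (IsLocalRing.mem_maximalIdeal _).2 hnu
    rw [← PadicInt.ker_toZMod, RingHom.mem_ker, hcoeff] at hmem
    exact one_ne_zero hmem
  have h := padicValNat_S_add_s₂ hu (factorial_mul_coeff_halfExp_pow h0 hE _ _)
  rw [s₂_mul_two_pow, s₂_two_mul_add_one] at h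
  rcases ha.lt_or_eq with ha | rfl
  · rw [s₂_mul_two_pow_add _ _ _ ha, s₂_two_mul] at h
    omega
  · have h1 : s₂ (2 ^ n) = 1 := by simpa [s₂] using s₂_mul_two_pow 1 n
    have h2 : s₂ (2 * d * 2 ^ n + 2 ^ n) = s₂ d + 1 := by
      rw [← Nat.succ_mul, s₂_mul_two_pow, Nat.succ_eq_add_one, s₂_two_mul_add_one]
    omega
end
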